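/- arXiv:2212.08839 — 3 statements merged into one kernel-verified Lean document; each statement's English description precedes it below -/
import Mathlib

section
/- Under Assumption 1 there exists a function G : ℝ → ℝ with the following properties: (a) G is differentiable on ℝ with Lipschitz continuous and bounded derivative G′ satisfying G′(ζ_k) = 1 for all k ∈ {1,…,m}, and there exists ε ∈ (0,∞) such that G′(x) = 1 for every x ∈ ℝ with |x| > ε; (b) G is a bijection of ℝ whose inverse G⁻¹ : ℝ → ℝ is Lipschitz continuous; (c) G′ is twice differentiable on each of the intervals (−∞,ζ₁), (ζ₁,ζ₂), …, (ζ_m,∞) with Lipschitz continuous and bounded derivatives G″ and G‴; and (d) for a suitable choice of values of G″ at the points ζ₁,…,ζ_m, the transformed coefficients μ̃ := (G′·μ + (1/2)·G″·σ²) ∘ G⁻¹ and σ̃ := (G′·σ) ∘ G⁻¹ satisfy: μ̃ is continuous on ℝ and Lipschitz continuous on [ζ₁,ζ_m]; μ̃ is globally one-sided Lipschitz on ℝ (there is L ∈ (0,∞) with (x−y)(μ̃(x)−μ̃(y)) ≤ L|x−y|² for all x,y ∈ ℝ); μ̃ is C¹ on each of the intervals (−∞,ζ₁), (ζ₁,ζ₂),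 …, (ζ_m,∞) with, wherever it exists, an at most polynomially growing derivative; σ̃ is Lipschitz continuous on ℝ; and σ̃(ζ_k) ≠ 0 for all k ∈ {1,…,m}. -/
open MeasureTheory ProbabilityTheory Real Set ENNReal

noncomputable section

def Assumption1 (n : ℕ) (ζ : Fin (n + 1) → ℝ) (μ σ : ℝ → ℝ) : Prop :=
  StrictMono ζ ∧
  (∃ K : ℝ, 0 < K ∧ ∀ i : Fin n, ∀ x ∈ Set.Ioo (ζ i.castSucc) (ζ i.succ),
      ∀ y ∈ Set.Ioo (ζ i.castSucc) (ζ i.succ), |μ x - μ y| ≤ K * |x - y|) ∧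
  (∃ L : ℝ, 0 < L ∧ ∀ x y : ℝ,
      ((x < ζ 0 ∧ y < ζ 0) ∨ (ζ (Fin.last n) < x ∧ ζ (Fin.last n) < y)) →
      (x - y) * (μ x - μ y) ≤ L * |x - y| ^ 2) ∧
  ContDiffOn ℝ 1 μ (Set.Iio (ζ 0)) ∧
  ContDiffOn ℝ 1 μ (Set.Ioi (ζ (Fin.last n))) ∧
  (∀ i : Fin n, ContDiffOn ℝ 1 μ (Set.Ioo (ζ i.castSucc) (ζ i.succ))) ∧
  (∃ C q : ℝ, 0 < C ∧ 0 < q ∧ ∀ x : ℝ,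
      x ∈ Set.Iio (ζ 0) ∪ Set.Ioi (ζ (Fin.last n)) ∪
          (⋃ i : Fin n, Set.Ioo (ζ i.castSucc) (ζ i.succ)) →
      |deriv μ x| ≤ C * (1 + |x| ^ q)) ∧
  (∃ Lσ : ℝ, 0 < Lσ ∧ ∀ x y : ℝ, |σ x - σ y| ≤ Lσ * |x - y|) ∧
  ContDiff ℝ 1 σ ∧
  (∃ Lσ' : ℝ, 0 < Lσ' ∧ ∀ x y : ℝ, |deriv σ x - deriv σ y| ≤ Lσ' * |x - y|) ∧
  (∀ k : Fin (n + 1), σ (ζ k) ≠ 0)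

/-- The open intervals determined by the discontinuity points
`(−∞,ζ₀), (ζ₀,ζ₁), …, (ζ_{last},∞)`. -/
def pieces (n : ℕ) (ζ : Fin (n + 1) → ℝ) : Set (Set ℝ) :=
  {Set.Iio (ζ 0), Set.Ioi (ζ (Fin.last n))} ∪
    Set.range (fun i : Fin n => Set.Ioo (ζ i.castSucc) (ζ i.succ))

section

open Filter Topology

theorem sub_le_mul_sub_of_hasDerivAt_le_off_finite {f : ℝ → ℝ} {L : ℝ} {S : Set ℝ}
    (hS : S.Finite) : ∀ {a b : ℝ}, a ≤ b → ContinuousOn f (Icc a b) →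
      (∀ x ∈ Ioo a b, x ∉ S → ∃ d, HasDerivAt f d x ∧ d ≤ L) → f b - f a ≤ L * (b - a) := by
  induction S, hS using Set.Finite.induction_on with
  | empty =>
    intro a b hab hc hd
    refine Convex.image_sub_le_mul_sub_of_deriv_le (convex_Icc a b) hc ?_ ?_ a
      (left_mem_Icc.2 hab) b (right_mem_Icc.2 hab) hab
    · intro x hx
      rw [interior_Icc] at hx
      obtain ⟨d, h, -⟩ := hd x hx (notMem_empty x)
      exact h.differentiableAt.differentiableWithinAt
    · intro x hx
      rw [interior_Icc] at hx
      obtain ⟨d, h, hle⟩ := hd x hx (notMem_empty x)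
      rwa [h.deriv]
  | @insert c S _ _ ih =>
    intro a b hab hc hd
    by_cases hcab : c ∈ Ioo a b
    · have h₁ := ih hcab.1.le (hc.mono (Icc_subset_Icc_right hcab.2.le)) fun x hx hxS =>
        hd x ⟨hx.1, hx.2.trans hcab.2⟩ (by simp [hxS, hx.2.ne])
      have h₂ := ih hcab.2.le (hc.mono (Icc_subset_Icc_left hcab.1.le)) fun x hx hxS =>
        hd x ⟨hcab.1.trans hx.1, hx.2⟩ (by simp [hxS, hx.1.ne'])
      linarith
    · refine ih hab hc fun x hx hxS => hd x hx ?_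
      rintro (rfl | h)
      exacts [hcab hx, hxS h]

theorem abs_sub_le_mul_of_hasDerivAt_le_off_finite {f : ℝ → ℝ} {L : ℝ} {S D : Set ℝ}
    (hS : S.Finite) (hD : D.OrdConnected) (hc : ContinuousOn f D)
    (hd : ∀ x ∈ D, x ∉ S → ∃ d, HasDerivAt f d x ∧ |d| ≤ L) {x y : ℝ} (hx : x ∈ D)
    (hy : y ∈ D) : |f x - f y| ≤ L * |x - y| := by
  wlog hxy : x ≤ y generalizing x y
  · rw [abs_sub_comm, abs_sub_comm x]
    exact this hy hx (le_of_not_ge hxy)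
  have hI := hD.out hx hy
  have h₁ := sub_le_mul_sub_of_hasDerivAt_le_off_finite hS hxy (hc.mono hI) fun z hz hzS =>
    let ⟨d, h, hle⟩ := hd z (hI (Ioo_subset_Icc_self hz)) hzS
    ⟨d, h, (abs_le.1 hle).2⟩
  have h₂ := sub_le_mul_sub_of_hasDerivAt_le_off_finite (f := fun z => -f z) (L := L) hS hxy
    (hc.mono hI).neg fun z hz hzS =>
    let ⟨d, h, hle⟩ := hd z (hI (Ioo_subset_Icc_self hz)) hzS
    ⟨-d, h.neg, by linarith [(abs_le.1 hle).1]⟩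
  rw [abs_sub_comm x, abs_of_nonneg (sub_nonneg.2 hxy), abs_le]
  constructor <;> linarith

theorem HasDerivAt.le_of_one_sided {f : ℝ → ℝ} {d L x : ℝ} (h : HasDerivAt f d x)
    (hL : ∀ᶠ y in 𝓝 x, (y - x) * (f y - f x) ≤ L * |y - x| ^ 2) : d ≤ L := by
  refine le_of_tendsto (hasDerivAt_iff_tendsto_slope.1 h) ?_
  filter_upwards [hL.filter_mono nhdsWithin_le_nhds, self_mem_nhdsWithin] with y hy hne
  have hne' : y - x ≠ 0 := sub_ne_zero.2 hne
  have hpos : 0 < (y - x) ^ 2 := by positivity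
  rw [sq_abs] at hy
  rw [slope_def_field, ← mul_le_mul_iff_left₀ hpos]
  calc (f y - f x) / (y - x) * (y - x) ^ 2 = (y - x) * (f y - f x) := by field_simp
    _ ≤ _ := hy

theorem contDiffOn_one_of_hasDerivAt {f f' : ℝ → ℝ} {s : Set ℝ} (hs : IsOpen s)
    (h : ∀ x ∈ s, HasDerivAt f (f' x) x) (hc : ContinuousOn f' s) : ContDiffOn ℝ 1 f s := by
  have := (contDiffOn_succ_iff_deriv_of_isOpen (n := 0) (f := f) (𝕜 := ℝ) hs).2
    ⟨fun x hx => (h x hx).differentiableAt.differentiableWithinAt, by simp,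
      contDiffOn_zero.2 (hc.congr fun x hx => (h x hx).deriv)⟩
  simpa using this

theorem exists_derivative_sequence_of_bump : ∃ P : ℕ → ℝ → ℝ,
    (∀ k x, HasDerivAt (P k) (P (k + 1) x) x) ∧ (∀ k x, 1 < |x| → P k x = 0) ∧
    P 0 0 = 0 ∧ P 1 0 = 0 ∧ P 2 0 = 2 := by
  let φ : ContDiffBump (0 : ℝ) := ⟨1 / 2, 1, by norm_num, by norm_num⟩
  let F : ℝ → ℝ := fun x => x ^ 2 * φ x
  have hF : ContDiff ℝ (⊤ : ℕ∞) F := (contDiff_id.pow 2).mul φ.contDiff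
  have hd : ∀ k x, HasDerivAt (iteratedDeriv k F) (iteratedDeriv (k + 1) F x) x := by
    intro k x
    rw [iteratedDeriv_succ]
    exact ((hF.differentiable_iteratedDeriv k (by exact_mod_cast WithTop.coe_lt_top _)) x).hasDerivAt
  have h0 : F =ᶠ[𝓝 0] fun x => x ^ 2 := by
    filter_upwards [φ.eventuallyEq_one] with x hx
    simp only [F]
    rw [hx]
    simp
  have hev : ∀ k, iteratedDeriv k F =ᶠ[𝓝 0] iteratedDeriv k (fun x : ℝ => x ^ 2) := by
    intro k
    induction k with
    | zero => simpa using h0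
    | succ k ih => simpa only [iteratedDeriv_succ] using ih.deriv
  refine ⟨fun k => iteratedDeriv k F, hd, ?_, ?_, ?_, ?_⟩
  · have hopen : IsOpen {x : ℝ | 1 < |x|} := isOpen_lt continuous_const continuous_abs
    intro k
    induction k with
    | zero =>
      intro x hx
      have : φ x = 0 := φ.zero_of_le_dist (by simpa using hx.le)
      simp [F, this]
    | succ k ih =>
      intro x hx
      change iteratedDeriv (k + 1) F x = 0
      have : iteratedDeriv k F =ᶠ[𝓝 x] fun _ => 0 := by
        filter_upwards [hopen.mem_nhds hx] with y hy using ih y hy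
      rw [iteratedDeriv_succ, this.deriv_eq, deriv_const]
  · simp [F]
  · simp [(hev 1).eq_of_nhds]
  · simp [(hev 2).eq_of_nhds]

theorem exists_bound_of_hasDerivAt_of_eq_zero {P P' : ℝ → ℝ} (h : ∀ x, HasDerivAt P (P' x) x)
    (h0 : ∀ x, 1 < |x| → P x = 0) : ∃ M, 0 < M ∧ ∀ x, |P x| ≤ M := by
  obtain ⟨M, hM⟩ := (isCompact_Icc (a := (-1 : ℝ)) (b := 1)).exists_bound_of_continuousOn
    (f := P) fun x _ => (h x).continuousAt.continuousWithinAt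
  refine ⟨|M| + 1, by positivity, fun x => ?_⟩
  by_cases hx : 1 < |x|
  · rw [h0 x hx, abs_zero]; positivity
  · have := hM x (abs_le.1 (not_lt.1 hx))
    rw [Real.norm_eq_abs] at this
    linarith [le_abs_self M]

/-- The odd kink profile: a function behaving like `v |v|` at the origin, supported in `[-1, 1]`,
together with its derivatives off the origin. -/
theorem exists_kink_profile : ∃ ρ : ℕ → ℝ → ℝ,
    (∀ k x, x ≠ 0 → HasDerivAt (ρ k) (ρ (k + 1) x) x) ∧
    (∀ x, HasDerivAt (ρ 0) (ρ 1 x) x) ∧ Continuous (ρ 1) ∧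
    (∀ k x, 1 < |x| → ρ k x = 0) ∧ ρ 0 0 = 0 ∧ ρ 1 0 = 0 ∧
    (∀ k, ∃ M, 0 < M ∧ ∀ x, |ρ k x| ≤ M) ∧
    Tendsto (ρ 2) (𝓝[>] 0) (𝓝 2) ∧ Tendsto (ρ 2) (𝓝[<] 0) (𝓝 (-2)) := by
  obtain ⟨P, hP, hP0, h00, h10, h20⟩ := exists_derivative_sequence_of_bump
  have hle : ∀ k x, |Real.sign x * P k x| ≤ |P k x| := by
    intro k x
    rcases Real.sign_apply_eq x with h | h | h <;> simp [h]
  have hd : ∀ k x, x ≠ 0 →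
      HasDerivAt (fun x => Real.sign x * P k x) (Real.sign x * P (k + 1) x) x := by
    intro k x hx
    have hs : (fun y => Real.sign y * P k y) =ᶠ[𝓝 x] fun y => Real.sign x * P k y := by
      rcases lt_or_gt_of_ne hx with h | h
      · filter_upwards [Iio_mem_nhds h] with y hy
        rw [Real.sign_of_neg h, Real.sign_of_neg hy]
      · filter_upwards [Ioi_mem_nhds h] with y hy
        rw [Real.sign_of_pos h, Real.sign_of_pos hy]
    exact ((hP k x).const_mul _).congr_of_eventuallyEq hs
  refine ⟨fun k x => Real.sign x * P k x, hd, ?_, ?_, ?_, by simp, by simp, ?_, ?_, ?_⟩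
  · intro x
    by_cases hx : x = 0
    · subst hx
      have h := hP 0 0
      rw [zero_add, h10, hasDerivAt_iff_isLittleO] at h
      simp only [Real.sign_zero, zero_mul]
      rw [hasDerivAt_iff_isLittleO]
      refine Asymptotics.IsBigO.trans_isLittleO (Asymptotics.IsBigO.of_bound 1 ?_) h
      refine Eventually.of_forall fun y => ?_
      simpa [h00] using hle 0 y
    · exact hd 0 x hx
  · refine continuous_iff_continuousAt.2 fun x => ?_
    by_cases hx : x = 0
    · subst hx
      have h : Tendsto (fun x => |P 1 x|) (𝓝 0) (𝓝 0) := by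
        have := (hP 1 0).continuousAt.abs
        rw [ContinuousAt, h10, abs_zero] at this
        exact this
      simp only [ContinuousAt, Real.sign_zero, zero_mul]
      exact squeeze_zero_norm (fun x => hle 1 x) h
    · exact (hd 1 x hx).continuousAt
  · intro k x hx
    simp [hP0 k x hx]
  · intro k
    obtain ⟨M, hM, hb⟩ := exists_bound_of_hasDerivAt_of_eq_zero (hP k) (hP0 k)
    exact ⟨M, hM, fun x => (hle k x).trans (hb x)⟩
  · have h : Tendsto (P 2) (𝓝[>] 0) (𝓝 2) := h20 ▸ (hP 2 0).continuousAt.tendsto.mono_left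
      nhdsWithin_le_nhds
    refine h.congr' ?_
    filter_upwards [self_mem_nhdsWithin] with x hx
    rw [Real.sign_of_pos hx, one_mul]
  · have h : Tendsto (P 2) (𝓝[<] 0) (𝓝 2) := h20 ▸ (hP 2 0).continuousAt.tendsto.mono_left
      nhdsWithin_le_nhds
    refine h.neg.congr' ?_
    filter_upwards [self_mem_nhdsWithin] with x hx
    rw [Real.sign_of_neg hx, neg_one_mul]

theorem exists_pos_lt_abs_sub {ι : Type*} [Finite ι] {ζ : ι → ℝ} (hζ : Function.Injective ζ) :
    ∃ δ, 0 < δ ∧ ∀ i j, i ≠ j → δ < |ζ i - ζ j| := by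
  have h : ∀ p : ι × ι, ∀ᶠ δ in 𝓝[>] (0 : ℝ), p.1 ≠ p.2 → δ < |ζ p.1 - ζ p.2| := by
    intro p
    by_cases hp : p.1 = p.2
    · simp [hp]
    · have : 0 < |ζ p.1 - ζ p.2| := abs_pos.2 (sub_ne_zero.2 (hζ.ne hp))
      filter_upwards [nhdsWithin_le_nhds (Iio_mem_nhds this)] with δ hδ _ using hδ
  obtain ⟨δ, hδ, hpos⟩ := ((eventually_all.2 h).and self_mem_nhdsWithin).exists
  exact ⟨δ, hpos, fun i j hij => hδ (i, j) hij⟩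

/-- A small compactly supported perturbation whose second derivative jumps from `-2 α i` to `2 α i`
at each point `ζ i`. The `k`-th derivative is `g k`. -/
theorem exists_kink_perturbation {ι : Type*} [Fintype ι] {ζ : ι → ℝ}
    (hζ : Function.Injective ζ) (α : ι → ℝ) : ∃ (g : ℕ → ℝ → ℝ) (R : ℝ), 0 < R ∧
    (∀ k x, x ∉ range ζ → HasDerivAt (g k) (g (k + 1) x) x) ∧
    (∀ x, HasDerivAt (g 0) (g 1 x) x) ∧ Continuous (g 1) ∧
    (∀ k x, R < |x| → g k x = 0) ∧ (∀ i, g 0 (ζ i) = 0) ∧ (∀ i, g 1 (ζ i) = 0) ∧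
    (∀ k, ∃ M, 0 < M ∧ ∀ x, |g k x| ≤ M) ∧ (∀ x, |g 1 x| ≤ 1 / 2) ∧
    (∀ i, Tendsto (g 2) (𝓝[>] ζ i) (𝓝 (2 * α i))) ∧
    (∀ i, Tendsto (g 2) (𝓝[<] ζ i) (𝓝 (-(2 * α i)))) := by
  classical
  obtain ⟨ρ, hd, hd0, hc1, hz, h00, h10, hb, hr, hl⟩ := exists_kink_profile
  obtain ⟨δ, hδ, hsep⟩ := exists_pos_lt_abs_sub hζ
  obtain ⟨M₁, hM₁, hb₁⟩ := hb 1
  set A : ℝ := ∑ i, |α i| with hA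
  have hA0 : 0 ≤ A := Finset.sum_nonneg fun i _ => abs_nonneg _
  obtain ⟨c, hc, hcδ, hcA⟩ : ∃ c : ℝ, 0 < c ∧ c ≤ δ ∧ c * (M₁ * A) ≤ 1 / 2 := by
    refine ⟨min δ (1 / (2 * (M₁ * A + 1))), by positivity, min_le_left _ _, ?_⟩
    calc _ ≤ 1 / (2 * (M₁ * A + 1)) * (M₁ * A) :=
          mul_le_mul_of_nonneg_right (min_le_right _ _) (by positivity)
      _ ≤ 1 / 2 := by
          rw [div_mul_eq_mul_div, div_le_div_iff₀ (by positivity) (by positivity)]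
          nlinarith [mul_nonneg hM₁.le hA0]
  have hfar : ∀ k i j, i ≠ j → ρ k ((ζ j - ζ i) * c⁻¹) = 0 := by
    intro k i j hij
    refine hz k _ ?_
    rw [abs_mul, abs_inv, abs_of_pos hc, ← div_eq_mul_inv, one_lt_div hc]
    exact hcδ.trans_lt (hsep j i hij.symm)
  have haff : ∀ i x, HasDerivAt (fun x => (x - ζ i) * c⁻¹) c⁻¹ x := by
    intro i x
    simpa using ((hasDerivAt_id x).sub_const (ζ i)).mul_const c⁻¹
  have hterm : ∀ k i x, HasDerivAt (ρ k) (ρ (k + 1) ((x - ζ i) * c⁻¹)) ((x - ζ i) * c⁻¹) →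
      HasDerivAt (fun x => α i * c ^ 2 * c⁻¹ ^ k * ρ k ((x - ζ i) * c⁻¹))
        (α i * c ^ 2 * c⁻¹ ^ (k + 1) * ρ (k + 1) ((x - ζ i) * c⁻¹)) x := by
    intro k i x h
    refine ((h.comp x (haff i x)).const_mul (α i * c ^ 2 * c⁻¹ ^ k)).congr_deriv ?_
    ring
  have hside : ∀ (i : ι) (l : Filter ℝ) (s : ℝ), l ≤ 𝓝 (ζ i) →
      Tendsto (fun x => ρ 2 ((x - ζ i) * c⁻¹)) l (𝓝 s) →
      Tendsto (fun x => ∑ j, α j * c ^ 2 * c⁻¹ ^ 2 * ρ 2 ((x - ζ j) * c⁻¹)) l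
        (𝓝 (α i * s)) := by
    intro i l s hl' hs
    have key : Tendsto (fun x => ∑ j, α j * c ^ 2 * c⁻¹ ^ 2 * ρ 2 ((x - ζ j) * c⁻¹)) l
        (𝓝 (∑ j, if j = i then α i * s else 0)) := by
      refine tendsto_finsetSum _ fun j _ => ?_
      by_cases hji : j = i
      · subst hji
        rw [if_pos rfl]
        have : α j * c ^ 2 * c⁻¹ ^ 2 = α j := by field_simp
        simpa only [this] using hs.const_mul (α j)
      · rw [if_neg hji]
        have hne : (ζ i - ζ j) * c⁻¹ ≠ 0 :=
          mul_ne_zero (sub_ne_zero.2 (hζ.ne (Ne.symm hji))) (inv_ne_zero hc.ne')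
        have := (hterm 2 j (ζ i) (hd 2 _ hne)).continuousAt.tendsto.mono_left hl'
        rwa [hfar 2 j i hji, mul_zero] at this
    simpa using key
  refine ⟨fun k x => ∑ i, α i * c ^ 2 * c⁻¹ ^ k * ρ k ((x - ζ i) * c⁻¹),
    c + ∑ i, |ζ i|, by positivity, ?_, ?_, ?_, ?_, ?_, ?_, ?_, ?_, ?_, ?_⟩
  · intro k x hx
    refine HasDerivAt.fun_sum fun i _ => hterm k i x (hd k _ ?_)
    refine mul_ne_zero (sub_ne_zero.2 ?_) (inv_ne_zero hc.ne')
    rintro rfl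
    exact hx ⟨i, rfl⟩
  · exact fun x => HasDerivAt.fun_sum fun i _ => hterm 0 i x (hd0 _)
  · fun_prop
  · intro k x hx
    refine Finset.sum_eq_zero fun i _ => ?_
    rw [hz, mul_zero]
    rw [abs_mul, abs_inv, abs_of_pos hc, ← div_eq_mul_inv, one_lt_div hc]
    have h₁ : |ζ i| ≤ ∑ i, |ζ i| :=
      Finset.single_le_sum (f := fun i => |ζ i|) (fun _ _ => abs_nonneg _) (Finset.mem_univ i)
    linarith [abs_sub_abs_le_abs_sub x (ζ i)]
  · intro j
    refine Finset.sum_eq_zero fun i _ => ?_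
    by_cases hij : i = j
    · simp [hij, h00]
    · rw [hfar _ _ _ hij, mul_zero]
  · intro j
    refine Finset.sum_eq_zero fun i _ => ?_
    by_cases hij : i = j
    · simp [hij, h10]
    · rw [hfar _ _ _ hij, mul_zero]
  · intro k
    obtain ⟨M, hM, hbM⟩ := hb k
    refine ⟨(∑ i, |α i * c ^ 2 * c⁻¹ ^ k| * M) + 1, by positivity, fun x => ?_⟩
    refine (Finset.abs_sum_le_sum_abs _ _).trans ((Finset.sum_le_sum fun i _ => ?_).trans
      (le_add_of_nonneg_right zero_le_one))
    rw [abs_mul]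
    exact mul_le_mul_of_nonneg_left (hbM _) (abs_nonneg _)
  · intro x
    refine (Finset.abs_sum_le_sum_abs _ _).trans (le_trans ?_ hcA)
    rw [hA, Finset.mul_sum, Finset.mul_sum]
    refine Finset.sum_le_sum fun i _ => ?_
    have : α i * c ^ 2 * c⁻¹ ^ 1 = c * α i := by field_simp
    rw [this, abs_mul, abs_mul, abs_of_pos hc, mul_assoc, mul_comm M₁]
    gcongr
    exact hb₁ _
  · intro i
    rw [mul_comm]
    refine hside i _ 2 nhdsWithin_le_nhds (hr.comp ?_)
    refine tendsto_nhdsWithin_iff.2 ⟨?_, ?_⟩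
    · have := (haff i (ζ i)).continuousAt.tendsto.mono_left (nhdsWithin_le_nhds (s := Ioi (ζ i)))
      simpa using this
    · filter_upwards [self_mem_nhdsWithin] with x hx
      exact mul_pos (sub_pos.2 hx) (inv_pos.2 hc)
  · intro i
    rw [mul_comm, ← mul_neg]
    refine hside i _ (-2) nhdsWithin_le_nhds (hl.comp ?_)
    refine tendsto_nhdsWithin_iff.2 ⟨?_, ?_⟩
    · have := (haff i (ζ i)).continuousAt.tendsto.mono_left (nhdsWithin_le_nhds (s := Iio (ζ i)))
      simpa using this
    · filter_upwards [self_mem_nhdsWithin] with x hx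
      exact mul_neg_of_neg_of_pos (sub_neg.2 hx) (inv_pos.2 hc)

theorem isOpen_of_mem_pieces {n : ℕ} {ζ : Fin (n + 1) → ℝ} {s : Set ℝ} (hs : s ∈ pieces n ζ) :
    IsOpen s := by
  rcases hs with (rfl | rfl) | ⟨i, rfl⟩
  exacts [isOpen_Iio, isOpen_Ioi, isOpen_Ioo]

theorem ordConnected_of_mem_pieces {n : ℕ} {ζ : Fin (n + 1) → ℝ} {s : Set ℝ}
    (hs : s ∈ pieces n ζ) : s.OrdConnected := by
  rcases hs with (rfl | rfl) | ⟨i, rfl⟩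
  exacts [ordConnected_Iio, ordConnected_Ioi, ordConnected_Ioo]

theorem notMem_range_of_mem_pieces {n : ℕ} {ζ : Fin (n + 1) → ℝ} (hζ : StrictMono ζ) {s : Set ℝ}
    (hs : s ∈ pieces n ζ) {x : ℝ} (hx : x ∈ s) : x ∉ range ζ := by
  rintro ⟨j, rfl⟩
  rcases hs with (rfl | rfl) | ⟨i, rfl⟩
  · exact absurd (hζ.lt_iff_lt.1 hx) (Fin.not_lt_zero j)
  · exact absurd (hζ.lt_iff_lt.1 hx) (Fin.le_last j).not_gt
  · have h₁ := hζ.lt_iff_lt.1 hx.1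
    have h₂ := hζ.lt_iff_lt.1 hx.2
    rw [Fin.lt_def] at h₁ h₂
    simp at h₁ h₂
    omega

theorem exists_mem_pieces {n : ℕ} {ζ : Fin (n + 1) → ℝ} {x : ℝ} (hx : x ∉ range ζ) :
    ∃ s ∈ pieces n ζ, x ∈ s := by
  by_contra! H
  have hall : ∀ i, ζ i < x := by
    intro i
    have hne : ∀ j, ζ j ≠ x := fun j hj => hx ⟨j, hj⟩
    induction i using Fin.induction with
    | zero => exact lt_of_le_of_ne (not_lt.1 (H _ (Or.inl (Or.inl rfl)))) (hne 0)
    | succ i ih =>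
      refine lt_of_le_of_ne (not_lt.1 fun h => H _ (Or.inr ⟨i, rfl⟩) ⟨ih, h⟩) (hne _)
  exact H _ (Or.inl (Or.inr rfl)) (hall _)

theorem StrictMono.mem_pieces_of_fixed {n : ℕ} {ζ : Fin (n + 1) → ℝ} {f : ℝ → ℝ}
    (hf : StrictMono f) (hfix : ∀ i, f (ζ i) = ζ i) {s : Set ℝ} (hs : s ∈ pieces n ζ) {x : ℝ}
    (hx : x ∈ s) : f x ∈ s := by
  rcases hs with (rfl | rfl) | ⟨i, rfl⟩
  · exact (hf hx).trans_eq (hfix _)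
  · exact (hfix _).symm.trans_lt (hf hx)
  · exact ⟨(hfix _).symm.trans_lt (hf hx.1), (hf hx.2).trans_eq (hfix _)⟩

theorem exists_tendsto_of_hasDerivAt_le {f : ℝ → ℝ} {M : ℝ} {s : Set ℝ} (hs : s.OrdConnected)
    (hd : ∀ x ∈ s, ∃ d, HasDerivAt f d x ∧ |d| ≤ M) (a : ℝ) : ∃ l, Tendsto f (𝓝[s] a) (𝓝 l) := by
  have hL : LipschitzOnWith M.toNNReal f s := by
    refine LipschitzOnWith.of_dist_le_mul fun x hx y hy => ?_
    rw [Real.dist_eq, Real.dist_eq]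
    refine (abs_sub_le_mul_of_hasDerivAt_le_off_finite finite_empty hs
      (fun z hz => ?_) (fun z hz _ => hd z hz) hx hy).trans ?_
    · obtain ⟨d, h, -⟩ := hd z hz
      exact h.continuousAt.continuousWithinAt
    · gcongr
      exact Real.le_coe_toNNReal M
  obtain ⟨F, hF, hEq⟩ := hL.extend_real
  refine ⟨F a, (hF.continuous.continuousAt.tendsto.mono_left nhdsWithin_le_nhds).congr' ?_⟩
  filter_upwards [self_mem_nhdsWithin] with x hx using (hEq hx).symm

theorem Assumption1.exists_deriv_bounds {n : ℕ} {ζ : Fin (n + 1) → ℝ} {μ σ : ℝ → ℝ}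
    (h : Assumption1 n ζ μ σ) :
    (∀ s ∈ pieces n ζ, ContDiffOn ℝ 1 μ s) ∧
    (∀ x ∉ range ζ, HasDerivAt μ (deriv μ x) x) ∧
    (∃ L, 0 < L ∧ (∀ x ∉ range ζ, deriv μ x ≤ L) ∧
      ∀ x ∈ Icc (ζ 0) (ζ (Fin.last n)), x ∉ range ζ → |deriv μ x| ≤ L) ∧
    (∃ C q : ℝ, 0 < C ∧ 0 < q ∧ ∀ x ∉ range ζ, |deriv μ x| ≤ C * (1 + |x| ^ q)) := by
  obtain ⟨hζ, ⟨K, hK, hKμ⟩, ⟨L, hL, hLμ⟩, hμl, hμr, hμi, ⟨C, q, hC, hq, hCq⟩, -⟩ := h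
  have hcd : ∀ s ∈ pieces n ζ, ContDiffOn ℝ 1 μ s := by
    rintro s ((rfl | rfl) | ⟨i, rfl⟩)
    exacts [hμl, hμr, hμi i]
  have hder : ∀ x ∉ range ζ, HasDerivAt μ (deriv μ x) x := by
    intro x hx
    obtain ⟨s, hs, hxs⟩ := exists_mem_pieces hx
    exact (((hcd s hs).contDiffAt ((isOpen_of_mem_pieces hs).mem_nhds hxs)).differentiableAt
      one_ne_zero).hasDerivAt
  have hin : ∀ i : Fin n, ∀ x ∈ Ioo (ζ i.castSucc) (ζ i.succ), |deriv μ x| ≤ K := by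
    intro i x hx
    have hd := hder x (notMem_range_of_mem_pieces hζ (Or.inr ⟨i, rfl⟩) hx)
    have hev : ∀ᶠ y in 𝓝 x, |(y - x) * (μ y - μ x)| ≤ K * |y - x| ^ 2 := by
      filter_upwards [isOpen_Ioo.mem_nhds hx] with y hy
      rw [abs_mul]
      nlinarith [hKμ i y hy x hx, abs_nonneg (y - x)]
    refine abs_le.2 ⟨?_, hd.le_of_one_sided (hev.mono fun y hy => (le_abs_self _).trans hy)⟩
    have : -deriv μ x ≤ K := (hd.neg).le_of_one_sided (hev.mono fun y hy => by
      simp only [Pi.neg_apply]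
      linarith [(abs_le.1 hy).1])
    linarith
  refine ⟨hcd, hder, ⟨max L K, lt_max_of_lt_left hL, ?_, ?_⟩, C, q, hC, hq, ?_⟩
  · intro x hx
    obtain ⟨s, hs, hxs⟩ := exists_mem_pieces hx
    rcases hs with (rfl | rfl) | ⟨i, rfl⟩
    · refine le_max_of_le_left ((hder x hx).le_of_one_sided ?_)
      filter_upwards [isOpen_Iio.mem_nhds hxs] with y hy using hLμ y x (Or.inl ⟨hy, hxs⟩)
    · refine le_max_of_le_left ((hder x hx).le_of_one_sided ?_)
      filter_upwards [isOpen_Ioi.mem_nhds hxs] with y hy using hLμ y x (Or.inr ⟨hy, hxs⟩)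
    · exact le_max_of_le_right ((le_abs_self _).trans (hin i x hxs))
  · intro x hxI hx
    obtain ⟨s, hs, hxs⟩ := exists_mem_pieces hx
    rcases hs with (rfl | rfl) | ⟨i, rfl⟩
    · exact absurd hxI.1 (not_le.2 hxs)
    · exact absurd hxI.2 (not_le.2 hxs)
    · exact le_max_of_le_right (hin i x hxs)
  · intro x hx
    refine hCq x ?_
    obtain ⟨s, hs, hxs⟩ := exists_mem_pieces hx
    rcases hs with (rfl | rfl) | ⟨i, rfl⟩
    exacts [Or.inl (Or.inl hxs), Or.inl (Or.inr hxs), Or.inr (mem_iUnion.2 ⟨i, hxs⟩)]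

theorem exists_one_sided_limits {ι : Type*} [Finite ι] {ζ : ι → ℝ} (hζ : Function.Injective ζ)
    {f : ℝ → ℝ} {C q : ℝ} (hC : 0 < C) (hq : 0 < q) (hd : ∀ x ∉ range ζ, HasDerivAt f (deriv f x) x)
    (hb : ∀ x ∉ range ζ, |deriv f x| ≤ C * (1 + |x| ^ q)) (i : ι) :
    (∃ l, Tendsto f (𝓝[>] ζ i) (𝓝 l)) ∧ ∃ l, Tendsto f (𝓝[<] ζ i) (𝓝 l) := by
  obtain ⟨δ, hδ, hsep⟩ := exists_pos_lt_abs_sub hζ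
  have hnear : ∀ x, x ≠ ζ i → |x - ζ i| < δ →
      ∃ d, HasDerivAt f d x ∧ |d| ≤ C * (1 + (|ζ i| + δ) ^ q) := by
    intro x hne hx
    have hxr : x ∉ range ζ := by
      rintro ⟨j, rfl⟩
      exact (hsep j i fun h => hne (h ▸ rfl)).not_gt hx
    refine ⟨_, hd x hxr, (hb x hxr).trans ?_⟩
    gcongr
    linarith [abs_sub_abs_le_abs_sub x (ζ i)]
  constructor
  · rw [← nhdsWithin_Ioo_eq_nhdsGT (lt_add_of_pos_right (ζ i) hδ)]
    refine exists_tendsto_of_hasDerivAt_le ordConnected_Ioo (fun x hx => hnear x hx.1.ne' ?_) _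
    rw [abs_lt]
    constructor <;> linarith [hx.1, hx.2]
  · rw [← nhdsWithin_Ioo_eq_nhdsLT (sub_lt_self (ζ i) hδ)]
    refine exists_tendsto_of_hasDerivAt_le ordConnected_Ioo (fun x hx => hnear x hx.2.ne ?_) _
    rw [abs_lt]
    constructor <;> linarith [hx.1, hx.2]

/-- A perturbation of the identity by a compactly supported function with derivative at most `1/2`
has a strictly increasing, Lipschitz continuous and differentiable inverse. -/
theorem exists_inverse_of_small_perturbation {g g' : ℝ → ℝ} {R : ℝ}
    (hd : ∀ x, HasDerivAt g (g' x) x) (hb : ∀ x, |g' x| ≤ 1 / 2) (hz : ∀ x, R < |x| → g x = 0) :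
    ∃ Ginv : ℝ → ℝ, Function.LeftInverse Ginv (fun x => x + g x) ∧
      Function.RightInverse Ginv (fun x => x + g x) ∧ StrictMono Ginv ∧
      (∀ x y, |Ginv x - Ginv y| ≤ 2 * |x - y|) ∧
      (∀ z, HasDerivAt Ginv (1 + g' (Ginv z))⁻¹ z) ∧ ∀ z, |Ginv z| ≤ |z| + |R| := by
  set G : ℝ → ℝ := fun x => x + g x with hG
  have hGd : ∀ x, HasDerivAt G (1 + g' x) x := fun x => (hasDerivAt_id x).add (hd x)
  have hpos : ∀ x, 1 / 2 ≤ 1 + g' x := fun x => by linarith [(abs_le.1 (hb x)).1]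
  have hGc : Continuous G := continuous_iff_continuousAt.2 fun x => (hGd x).continuousAt
  have hexp : ∀ {x y}, x ≤ y → y - x ≤ 2 * (G y - G x) := by
    intro x y hxy
    have := sub_le_mul_sub_of_hasDerivAt_le_off_finite (f := fun x => -G x) (L := -(1 / 2))
      finite_empty hxy hGc.neg.continuousOn fun z _ _ =>
        ⟨_, (hGd z).neg, by linarith [hpos z]⟩
    linarith
  have hmono : StrictMono G := fun x y hxy => by linarith [hexp hxy.le]
  have hsurj : Function.Surjective G := by
    refine hGc.surjective (tendsto_id.congr' ?_) (tendsto_id.congr' ?_)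
    · filter_upwards [eventually_gt_atTop R] with x hx
      simp [hG, hz x (hx.trans_le (le_abs_self x))]
    · filter_upwards [eventually_lt_atBot (-R)] with x hx
      simp [hG, hz x (by linarith [neg_le_abs x])]
  let e : ℝ ≃ ℝ := Equiv.ofBijective G ⟨hmono.injective, hsurj⟩
  have hr : Function.RightInverse e.symm G := e.apply_symm_apply
  have hl : Function.LeftInverse e.symm G := e.symm_apply_apply
  have hsm : StrictMono e.symm := fun x y hxy => hmono.lt_iff_lt.1 (by rwa [hr, hr])
  have hlip : ∀ x y, |e.symm x - e.symm y| ≤ 2 * |x - y| := by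
    intro x y
    wlog hxy : x ≤ y generalizing x y
    · rw [abs_sub_comm, abs_sub_comm x]
      exact this y x (le_of_not_ge hxy)
    have h := hexp (hsm.monotone hxy)
    rw [hr, hr] at h
    rwa [abs_sub_comm, abs_sub_comm x, abs_of_nonneg (sub_nonneg.2 (hsm.monotone hxy)),
      abs_of_nonneg (sub_nonneg.2 hxy)]
  have hcont : Continuous e.symm :=
    (LipschitzWith.of_dist_le_mul (K := 2) fun x y => by
      simpa [Real.dist_eq] using hlip x y).continuous
  refine ⟨e.symm, hl, hr, hsm, hlip, fun z => ?_, fun z => ?_⟩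
  · exact HasDerivAt.of_local_left_inverse hcont.continuousAt (hGd _)
      (by linarith [hpos (e.symm z)]) (Eventually.of_forall hr)
  · by_cases h : R < |e.symm z|
    · have h₁ := hr z
      simp only [hG, hz _ h, add_zero] at h₁
      rw [h₁]
      exact le_add_of_nonneg_right (abs_nonneg R)
    · linarith [le_abs_self R, abs_nonneg z]

theorem exists_bound_of_eq_zero_off_compact {f b : ℝ → ℝ} {R : ℝ} (hf : Continuous f)
    (hz : ∀ x, R < |x| → b x = 0) {S : Set ℝ} (hb : ∀ x ∉ S, |b x| ≤ |f x|) :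
    ∃ B, 0 < B ∧ ∀ x ∉ S, |b x| ≤ B := by
  obtain ⟨M, hM⟩ := (isCompact_Icc (a := -R) (b := R)).exists_bound_of_continuousOn
    (f := f) hf.continuousOn
  refine ⟨|M| + 1, by positivity, fun x hx => ?_⟩
  by_cases hR : R < |x|
  · rw [hz x hR, abs_zero]; positivity
  · have h₁ := hM x (abs_le.1 (not_lt.1 hR))
    rw [Real.norm_eq_abs] at h₁
    linarith [hb x hx, le_abs_self M]

/-- Existence of a compactly supported perturbation `g 0` of the identity whose kinks cancel the
jumps of the drift. -/
theorem Assumption1.exists_jump_cancelling {n : ℕ} {ζ : Fin (n + 1) → ℝ} {μ σ : ℝ → ℝ}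
    (h : Assumption1 n ζ μ σ) : ∃ (g : ℕ → ℝ → ℝ) (R : ℝ) (Gpp : ℝ → ℝ), 0 < R ∧
    (∀ k x, x ∉ range ζ → HasDerivAt (g k) (g (k + 1) x) x) ∧
    (∀ x, HasDerivAt (g 0) (g 1 x) x) ∧ Continuous (g 1) ∧
    (∀ k x, R < |x| → g k x = 0) ∧ (∀ i, g 0 (ζ i) = 0) ∧ (∀ i, g 1 (ζ i) = 0) ∧
    (∀ k, ∃ M, 0 < M ∧ ∀ x, |g k x| ≤ M) ∧ (∀ x, |g 1 x| ≤ 1 / 2) ∧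
    (∀ x ∉ range ζ, Gpp x = g 2 x) ∧ (∀ x ∉ range ζ, HasDerivAt Gpp (g 3 x) x) ∧
    (∃ M, 0 < M ∧ ∀ x, |Gpp x| ≤ M) ∧
    Continuous fun x => (1 + g 1 x) * μ x + 1 / 2 * Gpp x * σ x ^ 2 := by
  obtain ⟨-, hder, -, C, q, hC, hq, hCq⟩ := h.exists_deriv_bounds
  obtain ⟨hζ, -, -, -, -, -, -, -, hσ, -, hσ0⟩ := h
  have hσc : Continuous σ := hσ.continuous
  choose hlr hll using exists_one_sided_limits hζ.injective hC hq hder hCq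
  choose lr hlr using hlr
  choose ll hll using hll
  obtain ⟨g, R, hR, hg, hg0, hg1c, hgz, hgζ0, hgζ1, hgb, hg1b, hgr, hgl⟩ :=
    exists_kink_perturbation hζ.injective fun i => (ll i - lr i) / (2 * σ (ζ i) ^ 2)
  set w : Fin (n + 1) → ℝ := fun i => (ll i + lr i - 2 * μ (ζ i)) / σ (ζ i) ^ 2 with hw
  set Gpp : ℝ → ℝ := Function.extend ζ w (g 2) with hGpp
  have hoff : ∀ x ∉ range ζ, Gpp x = g 2 x := fun x hx =>
    Function.extend_apply' _ _ _ fun ⟨i, hi⟩ => hx ⟨i, hi⟩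
  have hon : ∀ i, Gpp (ζ i) = w i := fun i => hζ.injective.extend_apply _ _ _
  have hopen : IsOpen (range ζ)ᶜ := (finite_range ζ).isClosed.isOpen_compl
  have hGd : ∀ x ∉ range ζ, HasDerivAt Gpp (g 3 x) x := fun x hx =>
    (hg 2 x hx).congr_of_eventuallyEq (by
      filter_upwards [hopen.mem_nhds hx] with y hy using hoff y hy)
  refine ⟨g, R, Gpp, hR, hg, hg0, hg1c, hgz, hgζ0, hgζ1, hgb, hg1b, hoff, hGd, ?_, ?_⟩
  · obtain ⟨M, hM, hMb⟩ := hgb 2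
    refine ⟨M + ∑ i, |w i|, by positivity, fun x => ?_⟩
    by_cases hx : x ∈ range ζ
    · obtain ⟨i, rfl⟩ := hx
      rw [hon]
      have := Finset.single_le_sum (f := fun i => |w i|) (fun _ _ => abs_nonneg _)
        (Finset.mem_univ i)
      linarith
    · rw [hoff x hx]
      have : 0 ≤ ∑ i, |w i| := Finset.sum_nonneg fun _ _ => abs_nonneg _
      linarith [hMb x]
  · refine continuous_iff_continuousAt.2 fun x => ?_
    by_cases hx : x ∈ range ζ
    · obtain ⟨i, rfl⟩ := hx
      have hσi := hσ0 i
      have hne : ∀ l : Filter ℝ, l ≤ 𝓝[≠] ζ i → Gpp =ᶠ[l] g 2 := by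
        intro l hl
        have : ∀ᶠ y in 𝓝[≠] ζ i, y ∉ range ζ := by
          have hfin : ∀ᶠ y in 𝓝[≠] ζ i, y ∉ range ζ \ {ζ i} :=
            nhdsWithin_le_nhds
              (((finite_range ζ).sdiff (t := {ζ i})).isClosed.isOpen_compl.mem_nhds (by simp))
          filter_upwards [hfin, self_mem_nhdsWithin] with y hy hyi hyr using hy ⟨hyr, hyi⟩
        filter_upwards [hl this] with y hy using hoff y hy
      have hlim : ∀ (l : Filter ℝ) (a s : ℝ), l ≤ 𝓝[≠] ζ i → Tendsto μ l (𝓝 a) →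
          Tendsto (g 2) l (𝓝 s) → a + 1 / 2 * s * σ (ζ i) ^ 2 = (ll i + lr i) / 2 →
          Tendsto (fun x => (1 + g 1 x) * μ x + 1 / 2 * Gpp x * σ x ^ 2) l
            (𝓝 ((1 + g 1 (ζ i)) * μ (ζ i) + 1 / 2 * Gpp (ζ i) * σ (ζ i) ^ 2)) := by
        intro l a s hl ha hs heq
        have hl' : l ≤ 𝓝 (ζ i) := hl.trans nhdsWithin_le_nhds
        have hval : (1 + g 1 (ζ i)) * μ (ζ i) + 1 / 2 * Gpp (ζ i) * σ (ζ i) ^ 2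
            = (1 + g 1 (ζ i)) * a + 1 / 2 * s * σ (ζ i) ^ 2 := by
          rw [hgζ1, add_zero, one_mul, one_mul, heq, hon, hw]
          field_simp
          ring
        rw [hval]
        exact (((hg1c.tendsto _).mono_left hl').const_add 1 |>.mul ha).add
          (((hs.congr' (hne l hl).symm).const_mul _).mul (((hσc.tendsto _).mono_left hl').pow 2))
      refine continuousAt_iff_continuous_left'_right'.2 ⟨?_, ?_⟩
      · refine hlim _ _ _ (nhdsWithin_mono _ fun y hy => ne_of_lt hy) (hll i) (hgl i) ?_
        field_simp
        ring
      · refine hlim _ _ _ (nhdsWithin_mono _ fun y hy => ne_of_gt hy) (hlr i) (hgr i) ?_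
        field_simp
        ring
    · have h₁ := (hder x hx).continuousAt
      have h₂ := (hGd x hx).continuousAt
      fun_prop

end

/-- Existence of the transformation `G` with properties (a)–(d). -/
theorem exists_transform
    (n : ℕ) (ζ : Fin (n + 1) → ℝ) (μ σ : ℝ → ℝ)
    (h1 : Assumption1 n ζ μ σ) :
    ∃ (G Gpp Gppp Ginv : ℝ → ℝ),
      -- (a) G differentiable with Lipschitz, bounded derivative, G′(ζ_k)=1, G′ ≡ 1 far out
      Differentiable ℝ G ∧
      (∃ L : ℝ, 0 < L ∧ ∀ x y : ℝ, |deriv G x - deriv G y| ≤ L * |x - y|) ∧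
      (∃ B : ℝ, 0 < B ∧ ∀ x : ℝ, |deriv G x| ≤ B) ∧
      (∀ k : Fin (n + 1), deriv G (ζ k) = 1) ∧
      (∃ ε : ℝ, 0 < ε ∧ ∀ x : ℝ, ε < |x| → deriv G x = 1) ∧
      -- (b) G bijective with Lipschitz inverse Ginv
      Function.Bijective G ∧
      Function.LeftInverse Ginv G ∧ Function.RightInverse Ginv G ∧
      (∃ L : ℝ, 0 < L ∧ ∀ x y : ℝ, |Ginv x - Ginv y| ≤ L * |x - y|) ∧
      -- (c) G′ twice differentiable on each piece, with Lipschitz and bounded G″, G‴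
      (∀ s ∈ pieces n ζ, ∀ x ∈ s, HasDerivAt (deriv G) (Gpp x) x) ∧
      (∀ s ∈ pieces n ζ, ∀ x ∈ s, HasDerivAt Gpp (Gppp x) x) ∧
      (∃ L : ℝ, 0 < L ∧ ∀ s ∈ pieces n ζ, ∀ x ∈ s, ∀ y ∈ s,
        |Gpp x - Gpp y| ≤ L * |x - y| ∧ |Gppp x - Gppp y| ≤ L * |x - y|) ∧
      (∃ B : ℝ, 0 < B ∧ ∀ x : ℝ, |Gpp x| ≤ B ∧ |Gppp x| ≤ B) ∧
      -- (d) properties of the transformed coefficients μ̃ and σ̃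
      (∃ μt σt : ℝ → ℝ,
        (∀ z : ℝ, μt z = deriv G (Ginv z) * μ (Ginv z)
            + (1 / 2) * Gpp (Ginv z) * (σ (Ginv z)) ^ 2) ∧
        (∀ z : ℝ, σt z = deriv G (Ginv z) * σ (Ginv z)) ∧
        Continuous μt ∧
        (∃ K : ℝ, 0 < K ∧ ∀ x ∈ Set.Icc (ζ 0) (ζ (Fin.last n)),
          ∀ y ∈ Set.Icc (ζ 0) (ζ (Fin.last n)), |μt x - μt y| ≤ K * |x - y|) ∧
        (∃ L : ℝ, 0 < L ∧ ∀ x y : ℝ, (x - y) * (μt x - μt y) ≤ L * |x - y| ^ 2) ∧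
        (∀ s ∈ pieces n ζ, ContDiffOn ℝ 1 μt s) ∧
        (∃ C q : ℝ, 0 < C ∧ 0 < q ∧ ∀ x : ℝ, x ∈ ⋃₀ pieces n ζ →
          |deriv μt x| ≤ C * (1 + |x| ^ q)) ∧
        (∃ K : ℝ, 0 < K ∧ ∀ x y : ℝ, |σt x - σt y| ≤ K * |x - y|) ∧
        (∀ k : Fin (n + 1), σt (ζ k) ≠ 0)) := by
  obtain ⟨g, R, Gpp, hR, hg, hg0, hg1c, hgz, hgζ0, hgζ1, hgb, hg1b, hoff, hGpp, hGppb, hh⟩ :=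
    h1.exists_jump_cancelling
  obtain ⟨hμcd, hμ, ⟨L, hL, hμL, hμI⟩, C, q, hC, hq, hμC⟩ := h1.exists_deriv_bounds
  obtain ⟨hζ, -, -, -, -, -, -, ⟨Lσ, hLσ, hσL⟩, hσ, -, hσ0⟩ := h1
  obtain ⟨Ginv, hl, hr, hmono, hlip, hinv, hgrow⟩ :=
    exists_inverse_of_small_perturbation hg0 hg1b (hgz 0)
  have hfin : (range ζ).Finite := finite_range ζ
  have hG : ∀ x, HasDerivAt (fun x => x + g 0 x) (1 + g 1 x) x := fun x =>
    (hasDerivAt_id x).add (hg0 x)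
  have hG' : deriv (fun x => x + g 0 x) = fun x => 1 + g 1 x := funext fun x => (hG x).deriv
  have hpos : ∀ x, 1 / 2 ≤ 1 + g 1 x := fun x => by linarith [(abs_le.1 (hg1b x)).1]
  have hle2 : ∀ x, |1 + g 1 x| ≤ 2 := fun x => by
    rw [abs_le]; constructor <;> linarith [(abs_le.1 (hg1b x)).1, (abs_le.1 (hg1b x)).2]
  have hinv2 : ∀ x, |(1 + g 1 x)⁻¹| ≤ 2 := fun x => by
    rw [abs_inv, abs_of_pos (by linarith [hpos x])]
    exact (inv_le_comm₀ (by linarith [hpos x]) two_pos).2 (by linarith [hpos x])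
  have hGinvζ : ∀ i, Ginv (ζ i) = ζ i := fun i => by simpa [hgζ0] using hl (ζ i)
  have hGinvc : Continuous Ginv := continuous_iff_continuousAt.2 fun z => (hinv z).continuousAt
  have hGinvoff : ∀ z ∉ range ζ, Ginv z ∉ range ζ := by
    rintro z hz ⟨i, hi⟩
    exact hz ⟨i, hmono.injective ((hGinvζ i).trans hi)⟩
  have hσd : ∀ x, HasDerivAt σ (deriv σ x) x := fun x =>
    (hσ.differentiable one_ne_zero x).hasDerivAt
  have hσ'c : Continuous (deriv σ) := hσ.continuous_deriv le_rfl
  have hσ'b : ∀ x, |deriv σ x| ≤ Lσ := fun x => by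
    have hlipσ : LipschitzWith Lσ.toNNReal σ := LipschitzWith.of_dist_le_mul fun x y => by
      rw [Real.dist_eq, Real.dist_eq, Real.coe_toNNReal _ hLσ.le]
      exact hσL x y
    have := norm_deriv_le_of_lipschitz (x₀ := x) hlipσ
    rwa [Real.norm_eq_abs, Real.coe_toNNReal _ hLσ.le] at this
  have hσc : Continuous σ := hσ.continuous
  obtain ⟨M₂, hM₂, hb₂⟩ := hgb 2
  obtain ⟨M₃, hM₃, hb₃⟩ := hgb 3
  obtain ⟨M₄, hM₄, hb₄⟩ := hgb 4
  obtain ⟨M, hM, hb⟩ := hGppb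
  set H : ℝ → ℝ := fun x => (1 + g 1 x) * μ x + 1 / 2 * Gpp x * σ x ^ 2 with hHdef
  set b : ℝ → ℝ := fun x =>
    (g 2 x * μ x + (1 / 2 * g 3 x * σ x ^ 2 + g 2 x * σ x * deriv σ x)) * (1 + g 1 x)⁻¹ with hbdef
  have hHd : ∀ x ∉ range ζ, HasDerivAt H ((deriv μ x + b x) * (1 + g 1 x)) x := by
    intro x hx
    have hne : 1 + g 1 x ≠ 0 := by linarith [hpos x]
    refine ((((hg 1 x hx).const_add 1).mul (hμ x hx)).add
      (((hGpp x hx).const_mul (1 / 2)).mul ((hσd x).pow 2))).congr_deriv ?_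
    simp only [hbdef, hoff x hx, Pi.pow_apply]
    field_simp
    ring
  have hμtd : ∀ z ∉ range ζ,
      HasDerivAt (fun z => H (Ginv z)) (deriv μ (Ginv z) + b (Ginv z)) z := by
    intro z hz
    have hne : 1 + g 1 (Ginv z) ≠ 0 := by linarith [hpos (Ginv z)]
    refine ((hHd _ (hGinvoff z hz)).comp z (hinv z)).congr_deriv ?_
    field_simp
  have hσsupp : ∃ B, 0 < B ∧ ∀ x ∉ range ζ, |g 2 x * σ x| ≤ B := by
    refine exists_bound_of_eq_zero_off_compact (f := fun x => M₂ * σ x) (by fun_prop)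
      (fun x hx => by rw [hgz 2 x hx, zero_mul]) fun x _ => ?_
    rw [abs_mul, abs_mul, abs_of_pos hM₂]
    gcongr
    exact hb₂ x
  have hbsupp : ∃ B, 0 < B ∧ ∀ x ∉ range ζ, |b x| ≤ B := by
    refine exists_bound_of_eq_zero_off_compact (R := R)
      (f := fun x => (M₂ * ((|H x| + 1 / 2 * M₂ * |σ x| ^ 2) * 2) +
        (1 / 2 * M₃ * |σ x| ^ 2 + M₂ * |σ x| * |deriv σ x|)) * 2) (by fun_prop)
      (fun x hx => by simp [hbdef, hgz 2 x hx, hgz 3 x hx]) fun x hx => ?_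
    have hμx : |μ x| ≤ (|H x| + 1 / 2 * M₂ * |σ x| ^ 2) * 2 := by
      have hne : 1 + g 1 x ≠ 0 := by linarith [hpos x]
      have heq : μ x = (H x - 1 / 2 * g 2 x * σ x ^ 2) * (1 + g 1 x)⁻¹ := by
        simp only [hHdef, hoff x hx]
        field_simp
        ring
      rw [heq, abs_mul]
      gcongr
      · refine (abs_sub _ _).trans ?_
        rw [abs_mul, abs_mul, abs_pow, abs_of_pos (one_half_pos (α := ℝ))]
        gcongr
        exact hb₂ x
      · exact hinv2 x
    refine le_trans ?_ (le_abs_self _)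
    rw [hbdef, abs_mul]
    gcongr ?_ * ?_
    · refine (abs_add_le _ _).trans (add_le_add ?_ ((abs_add_le _ _).trans (add_le_add ?_ ?_)))
      · rw [abs_mul]
        gcongr
        exact hb₂ x
      · rw [abs_mul, abs_mul, abs_pow, abs_of_pos (one_half_pos (α := ℝ))]
        gcongr
        exact hb₃ x
      · rw [abs_mul, abs_mul]
        gcongr
        exact hb₂ x
    · exact hinv2 x
  obtain ⟨Bσ, hBσ, hσb⟩ := hσsupp
  obtain ⟨B, hB, hbb⟩ := hbsupp
  have hpiece : ∀ s ∈ pieces n ζ, ∀ x ∈ s, x ∉ range ζ := fun s hs x hx =>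
    notMem_range_of_mem_pieces hζ hs hx
  have hgcd : ∀ k, ∀ s ∈ pieces n ζ, ContDiffOn ℝ 1 (g k) s := fun k s hs =>
    contDiffOn_one_of_hasDerivAt (isOpen_of_mem_pieces hs)
      (fun x hx => hg k x (hpiece s hs x hx))
      fun x hx => (hg (k + 1) x (hpiece s hs x hx)).continuousAt.continuousWithinAt
  have hμtc : Continuous fun z => H (Ginv z) := hh.comp hGinvc
  refine ⟨fun x => x + g 0 x, Gpp, g 3, Ginv, fun x => (hG x).differentiableAt, ?_⟩
  rw [hG']
  refine ⟨⟨M₂, hM₂, fun x y => ?_⟩, ⟨2, two_pos, hle2⟩, fun k => by simp [hgζ1],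
    ⟨R, hR, fun x hx => by simp [hgz 1 x hx]⟩, ⟨hl.injective, hr.surjective⟩, hl, hr,
    ⟨2, two_pos, hlip⟩, fun s hs x hx => ?_, fun s hs x hx => hGpp x (hpiece s hs x hx),
    ⟨max M₃ M₄, lt_max_of_lt_left hM₃, fun s hs x hx y hy => ⟨?_, ?_⟩⟩,
    ⟨max M M₃, lt_max_of_lt_left hM, fun x =>
      ⟨le_max_of_le_left (hb x), le_max_of_le_right (hb₃ x)⟩⟩,
    fun z => H (Ginv z), fun z => (1 + g 1 (Ginv z)) * σ (Ginv z), fun z => rfl, fun z => rfl,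
    hμtc, ⟨L + B, by positivity, fun x hx y hy => ?_⟩,
    ⟨L + B, by positivity, fun x y => ?_⟩, fun s hs => ?_,
    ⟨C * (1 + (2 * R) ^ q + 2 ^ q) + B, q, by positivity, hq, fun z hz => ?_⟩,
    ⟨(Bσ + 2 * Lσ) * 2, by positivity, fun x y => ?_⟩, fun k => ?_⟩
  · exact abs_sub_le_mul_of_hasDerivAt_le_off_finite hfin ordConnected_univ
      (by fun_prop) (fun z _ hz => ⟨_, (hg 1 z hz).const_add 1, hb₂ z⟩) (mem_univ x) (mem_univ y)
  · rw [hoff x (hpiece s hs x hx)]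
    exact (hg 1 x (hpiece s hs x hx)).const_add 1
  · exact abs_sub_le_mul_of_hasDerivAt_le_off_finite hfin (ordConnected_of_mem_pieces hs)
      (fun z hz => (hGpp z (hpiece s hs z hz)).continuousAt.continuousWithinAt)
      (fun z _ hz => ⟨_, hGpp z hz, le_max_of_le_left (hb₃ z)⟩) hx hy
  · exact abs_sub_le_mul_of_hasDerivAt_le_off_finite hfin (ordConnected_of_mem_pieces hs)
      (fun z hz => (hg 3 z (hpiece s hs z hz)).continuousAt.continuousWithinAt)
      (fun z _ hz => ⟨_, hg 3 z hz, le_max_of_le_right (hb₄ z)⟩) hx hy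
  · refine abs_sub_le_mul_of_hasDerivAt_le_off_finite hfin ordConnected_Icc hμtc.continuousOn
      (fun z hz hzr => ⟨_, hμtd z hzr, (abs_add_le _ _).trans
        (add_le_add (hμI _ ⟨?_, ?_⟩ (hGinvoff z hzr)) (hbb _ (hGinvoff z hzr)))⟩) hx hy
    · rw [← hGinvζ 0]; exact hmono.monotone hz.1
    · rw [← hGinvζ (Fin.last n)]; exact hmono.monotone hz.2
  · wlog hxy : x ≤ y generalizing x y
    · have := this y x (le_of_not_ge hxy)
      rw [abs_sub_comm]
      linarith
    have := sub_le_mul_sub_of_hasDerivAt_le_off_finite hfin hxy hμtc.continuousOn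
      fun z _ hz => ⟨_, hμtd z hz, add_le_add (hμL _ (hGinvoff z hz))
        ((le_abs_self _).trans (hbb _ (hGinvoff z hz)))⟩
    rw [sq_abs]
    nlinarith [sub_nonneg.2 hxy]
  · have hcd : ContDiffOn ℝ 1 H s := by
      have hGpps : ContDiffOn ℝ 1 Gpp s :=
        (hgcd 2 s hs).congr fun x hx => hoff x (hpiece s hs x hx)
      exact ((contDiffOn_const.add (hgcd 1 s hs)).mul (hμcd s hs)).add
        ((contDiffOn_const.mul hGpps).mul (hσ.contDiffOn.pow 2))
    refine hcd.comp (contDiffOn_one_of_hasDerivAt (isOpen_of_mem_pieces hs)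
      (fun z _ => hinv z) ?_) fun z hz => hmono.mem_pieces_of_fixed hGinvζ hs hz
    refine Continuous.continuousOn (Continuous.inv₀ (by fun_prop) fun z => ?_)
    linarith [hpos (Ginv z)]
  · obtain ⟨s, hs, hzs⟩ := hz
    have hzr := hpiece s hs z hzs
    rw [(hμtd z hzr).deriv]
    have hzq : 0 ≤ |z| ^ q := by positivity
    have hpow : |Ginv z| ^ q ≤ (2 * R) ^ q + 2 ^ q * |z| ^ q := by
      rw [← Real.mul_rpow two_pos.le (abs_nonneg z)]
      have hgz' := hgrow z
      rw [abs_of_pos hR] at hgz'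
      rcases le_total |z| R with h | h
      · exact (Real.rpow_le_rpow (abs_nonneg _) (by linarith) hq.le).trans
          (le_add_of_nonneg_right (by positivity))
      · exact (Real.rpow_le_rpow (abs_nonneg _) (by linarith) hq.le).trans
          (le_add_of_nonneg_left (by positivity))
    have hR2 : 0 ≤ (2 * R) ^ q := by positivity
    have h2q : (0 : ℝ) ≤ 2 ^ q := by positivity
    calc |deriv μ (Ginv z) + b (Ginv z)|
        ≤ C * (1 + |Ginv z| ^ q) + B := (abs_add_le _ _).trans
          (add_le_add (hμC _ (hGinvoff z hzr)) (hbb _ (hGinvoff z hzr)))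
      _ ≤ C * (1 + ((2 * R) ^ q + 2 ^ q * |z| ^ q)) + B := by gcongr
      _ ≤ C * ((1 + (2 * R) ^ q + 2 ^ q) * (1 + |z| ^ q)) + B * (1 + |z| ^ q) := by
          gcongr
          · nlinarith [mul_nonneg hR2 hzq]
          · nlinarith
      _ = _ := by ring
  · refine abs_sub_le_mul_of_hasDerivAt_le_off_finite hfin ordConnected_univ (by fun_prop)
      (f := fun z => (1 + g 1 (Ginv z)) * σ (Ginv z))
      (fun z _ hz => ⟨_, (((hg 1 _ (hGinvoff z hz)).const_add 1).mul (hσd (Ginv z))).comp z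
        (hinv z), ?_⟩) (mem_univ x) (mem_univ y)
    rw [abs_mul]
    gcongr
    · refine (abs_add_le _ _).trans (add_le_add (hσb _ (hGinvoff z hz)) ?_)
      rw [abs_mul]
      gcongr
      exacts [hle2 _, hσ'b _]
    · exact hinv2 _
  · simpa [hGinvζ, hgζ1] using hσ0 k

end
end

section
/- Let a < b be real numbers and let f : ℝ → ℝ be continuous on ℝ, Lipschitz continuous on [a,b], and differentiable on (−∞,a) and on (b,∞), and suppose there exist C, q ∈ (0,∞) such that |f′(x)| ≤ C(1+|x|^q) for all x ∈ (−∞,a) ∪ (b,∞). Then there exists c̃ ∈ (0,∞) such that for all x, y ∈ ℝ, |f(x) − f(y)| ≤ c̃ (1 + |x|^{c̃} + |y|^{c̃}) |x − y|. -/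
open Set Real

noncomputable section

/-- Mean value inequality on an interval, with differentiability required only in its interior. -/
theorem abs_sub_le_of_abs_deriv_le_Ioo {f : ℝ → ℝ} {u v L : ℝ} (huv : u ≤ v)
    (hf : ContinuousOn f (Icc u v)) (hd : DifferentiableOn ℝ f (Ioo u v))
    (hL : ∀ z ∈ Ioo u v, |deriv f z| ≤ L) : |f u - f v| ≤ L * (v - u) := by
  rcases huv.eq_or_lt with rfl | h
  · simp
  obtain ⟨z, hz, hslope⟩ := exists_deriv_eq_slope f h hf hd
  have hvu : 0 < v - u := sub_pos.2 h
  rw [eq_div_iff hvu.ne'] at hslope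
  rw [abs_sub_comm, ← hslope, abs_mul, abs_of_pos hvu]
  exact mul_le_mul_of_nonneg_right (hL z hz) hvu.le

theorem abs_rpow_le_add_of_mem_Icc {x y z q : ℝ} (hq : 0 ≤ q) (hz : z ∈ Icc x y) :
    |z| ^ q ≤ |x| ^ q + |y| ^ q := by
  have hx : 0 ≤ |x| ^ q := by positivity
  have hy : 0 ≤ |y| ^ q := by positivity
  rcases le_max_iff.1 (abs_le_max_abs_abs hz.1 hz.2) with h | h
  · linarith [rpow_le_rpow (abs_nonneg z) h hq]
  · linarith [rpow_le_rpow (abs_nonneg z) h hq]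

theorem rpow_le_one_add_rpow {t q r : ℝ} (ht : 0 ≤ t) (hq : 0 ≤ q) (hqr : q ≤ r) :
    t ^ q ≤ 1 + t ^ r := by
  rcases le_total t 1 with h | h
  · linarith [rpow_le_one ht h hq, rpow_nonneg ht r]
  · linarith [rpow_le_rpow_of_exponent_le h hqr]

/-- A real function on the line splits along the two cut points `a ≤ b`. -/
theorem apply_eq_add_apply_clamp {a b : ℝ} (hab : a ≤ b) (g : ℝ → ℝ) (x : ℝ) :
    g x = g (min x a) + g (max a (min x b)) + g (max x b) - g a - g b := by
  rcases le_total x a with h | h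
  · rw [min_eq_left h, min_eq_left (h.trans hab), max_eq_left h, max_eq_right (h.trans hab)]
    ring
  rcases le_total x b with h' | h'
  · rw [min_eq_right h, min_eq_left h', max_eq_right h, max_eq_right h']
    ring
  · rw [min_eq_right h, min_eq_right h', max_eq_right hab, max_eq_left h']
    ring

/-- If `f : ℝ → ℝ` is continuous, Lipschitz on `[a,b]`, differentiable on `(-∞,a)` and `(b,∞)`
with `|f′(x)| ≤ C(1+|x|^q)` there, then there is `c̃ ∈ (0,∞)` with
`|f(x) − f(y)| ≤ c̃ (1 + |x|^c̃ + |y|^c̃) |x − y|` for all `x, y ∈ ℝ`. -/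
theorem polynomial_lipschitz_estimate
    (a b : ℝ) (hab : a < b) (f : ℝ → ℝ)
    (hcont : Continuous f)
    (hLip : ∃ K : ℝ, 0 < K ∧ ∀ x ∈ Set.Icc a b, ∀ y ∈ Set.Icc a b,
      |f x - f y| ≤ K * |x - y|)
    (hdiff₁ : DifferentiableOn ℝ f (Set.Iio a))
    (hdiff₂ : DifferentiableOn ℝ f (Set.Ioi b))
    (C q : ℝ) (hC : 0 < C) (hq : 0 < q)
    (hderiv : ∀ x ∈ Set.Iio a ∪ Set.Ioi b, |deriv f x| ≤ C * (1 + |x| ^ q)) :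
    ∃ ct : ℝ, 0 < ct ∧ ∀ x y : ℝ,
      |f x - f y| ≤ ct * (1 + |x| ^ ct + |y| ^ ct) * |x - y| := by
  obtain ⟨K, hK, hLip⟩ := hLip
  have key : ∀ x y : ℝ, x ≤ y →
      |f x - f y| ≤ (K + C * (1 + |x| ^ q + |y| ^ q)) * (y - x) := by
    intro x y hxy
    set L := K + C * (1 + |x| ^ q + |y| ^ q)
    have hKL : K ≤ L := le_add_of_nonneg_right (by positivity)
    have hbound : ∀ z ∈ Iio a ∪ Ioi b, z ∈ Icc x y → |deriv f z| ≤ L := fun z hz hzxy =>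
      calc |deriv f z| ≤ C * (1 + |z| ^ q) := hderiv z hz
        _ ≤ C * (1 + |x| ^ q + |y| ^ q) := by
          have := abs_rpow_le_add_of_mem_Icc hq.le hzxy
          rw [add_assoc 1]
          gcongr
        _ ≤ L := le_add_of_nonneg_left hK.le
    have hleft : |f (min x a) - f (min y a)| ≤ L * (min y a - min x a) := by
      refine abs_sub_le_of_abs_deriv_le_Ioo (min_le_min_right a hxy) hcont.continuousOn
        (hdiff₁.mono fun z hz => hz.2.trans_le (min_le_right y a)) fun z hz => ?_
      have hza : z < a := hz.2.trans_le (min_le_right y a)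
      have hzx : x < z := (min_lt_iff.1 hz.1).resolve_right hza.not_gt
      exact hbound z (Or.inl hza) ⟨hzx.le, (hz.2.trans_le (min_le_left y a)).le⟩
    have hright : |f (max x b) - f (max y b)| ≤ L * (max y b - max x b) := by
      refine abs_sub_le_of_abs_deriv_le_Ioo (max_le_max_right b hxy) hcont.continuousOn
        (hdiff₂.mono fun z hz => (le_max_right x b).trans_lt hz.1) fun z hz => ?_
      have hbz : b < z := (le_max_right x b).trans_lt hz.1
      have hzy : z < y := (lt_max_iff.1 hz.2).resolve_right hbz.not_gt
      exact hbound z (Or.inr hbz) ⟨((le_max_left x b).trans_lt hz.1).le, hzy.le⟩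
    have hmid : |f (max a (min x b)) - f (max a (min y b))|
        ≤ L * (max a (min y b) - max a (min x b)) := by
      have hmono : max a (min x b) ≤ max a (min y b) :=
        max_le_max_left a (min_le_min_right b hxy)
      have h := hLip (max a (min x b)) ⟨le_max_left _ _, max_le hab.le (min_le_right _ _)⟩
        (max a (min y b)) ⟨le_max_left _ _, max_le hab.le (min_le_right _ _)⟩
      rw [abs_sub_comm (max a (min x b)), abs_of_nonneg (sub_nonneg.2 hmono)] at h
      exact h.trans (mul_le_mul_of_nonneg_right hKL (sub_nonneg.2 hmono))
    have hlen : y - x = (min y a - min x a) + (max a (min y b) - max a (min x b))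
        + (max y b - max x b) := by
      linarith [apply_eq_add_apply_clamp hab.le (fun t => t) x,
        apply_eq_add_apply_clamp hab.le (fun t => t) y]
    have hsplit : f x - f y = (f (min x a) - f (min y a))
        + (f (max a (min x b)) - f (max a (min y b))) + (f (max x b) - f (max y b)) := by
      linarith [apply_eq_add_apply_clamp hab.le f x, apply_eq_add_apply_clamp hab.le f y]
    rw [hsplit, hlen, mul_add, mul_add]
    exact (abs_add_three _ _ _).trans (by gcongr)
  have hct : 0 < K + 3 * C + q := by positivity
  have hweight : ∀ x y : ℝ, K + C * (1 + |x| ^ q + |y| ^ q) ≤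
      (K + 3 * C + q) * (1 + |x| ^ (K + 3 * C + q) + |y| ^ (K + 3 * C + q)) := by
    intro x y
    have hqc : q ≤ K + 3 * C + q := by linarith
    have hx := rpow_le_one_add_rpow (abs_nonneg x) hq.le hqc
    have hy := rpow_le_one_add_rpow (abs_nonneg y) hq.le hqc
    have hX := rpow_nonneg (abs_nonneg x) (K + 3 * C + q)
    have hY := rpow_nonneg (abs_nonneg y) (K + 3 * C + q)
    generalize |x| ^ (K + 3 * C + q) = X at *
    generalize |y| ^ (K + 3 * C + q) = Y at *
    calc K + C * (1 + |x| ^ q + |y| ^ q) ≤ K + C * (1 + (1 + X) + (1 + Y)) := by gcongr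
      _ = (K + 3 * C) + C * (X + Y) := by ring
      _ ≤ (K + 3 * C + q) + (K + 3 * C + q) * (X + Y) :=
        add_le_add (by linarith) (mul_le_mul_of_nonneg_right (by linarith) (by linarith))
      _ = (K + 3 * C + q) * (1 + X + Y) := by ring
  refine ⟨K + 3 * C + q, hct, fun x y => ?_⟩
  wlog hxy : x ≤ y generalizing x y
  · have h := this y x (le_of_not_ge hxy)
    rwa [abs_sub_comm (f x), abs_sub_comm x, add_right_comm 1]
  rw [abs_sub_comm x, abs_of_nonneg (sub_nonneg.2 hxy)]
  exact (key x y hxy).trans (mul_le_mul_of_nonneg_right (hweight x y) (sub_nonneg.2 hxy))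

end
end

section
/- Under Assumption 1 there exists c ∈ (0,∞) such that for all δ ∈ (0,1) and all x ∈ ℝ, 2·x·μ(x)/(1 + δ|μ(x)|) ≤ c(1 + |x|²). -/
open MeasureTheory ProbabilityTheory Real Set ENNReal

noncomputable section

/-- A differentiable function with bounded derivative is bounded on a bounded open interval. -/
lemma isBounded_image_Ioo_of_deriv_bound {f : ℝ → ℝ} {a b M : ℝ}
    (hf : DifferentiableOn ℝ f (Set.Ioo a b)) (hM : ∀ x ∈ Set.Ioo a b, |deriv f x| ≤ M) :
    Bornology.IsBounded (f '' Set.Ioo a b) := by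
  have hmvt : ∀ x ∈ Set.Ioo a b, ∀ y ∈ Set.Ioo a b, ‖f y - f x‖ ≤ M * ‖y - x‖ := fun x hx y hy =>
    (convex_Ioo a b).norm_image_sub_le_of_norm_deriv_le
      (fun z hz => hf.differentiableAt (isOpen_Ioo.mem_nhds hz)) hM hx hy
  refine Metric.isBounded_iff.2 ⟨|M| * (b - a), ?_⟩
  rintro _ ⟨x, hx, rfl⟩ _ ⟨y, hy, rfl⟩
  rw [dist_eq_norm]
  have hxy : ‖x - y‖ ≤ b - a :=
    abs_le.2 ⟨by linarith [hx.1, hy.2], by linarith [hx.2, hy.1]⟩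
  exact (hmvt y hy x hx).trans (mul_le_mul (le_abs_self M) hxy (norm_nonneg _) (abs_nonneg _))

/-- A function bounded on the open intervals between consecutive nodes is bounded on their hull. -/
lemma isBounded_image_Icc_of_pieces {f : ℝ → ℝ} {n : ℕ} (ζ : Fin (n + 1) → ℝ)
    (h : ∀ i : Fin n, Bornology.IsBounded (f '' Set.Ioo (ζ i.castSucc) (ζ i.succ)))
    (k : Fin (n + 1)) : Bornology.IsBounded (f '' Set.Icc (ζ 0) (ζ k)) := by
  induction k using Fin.induction with
  | zero => simp
  | succ i ih =>
    refine ((ih.union (h i)).union (Bornology.isBounded_singleton (x := f (ζ i.succ)))).subset ?_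
    rintro _ ⟨x, ⟨h0, h1⟩, rfl⟩
    rcases le_or_gt x (ζ i.castSucc) with hx | hx
    · exact Or.inl (Or.inl ⟨x, ⟨h0, hx⟩, rfl⟩)
    · rcases h1.lt_or_eq with hlt | rfl
      · exact Or.inl (Or.inr ⟨x, ⟨hx, hlt⟩, rfl⟩)
      · exact Or.inr rfl

/-- A drift satisfying `Assumption1` is bounded on every bounded interval. -/
lemma Assumption1.isBounded_image_Ioo {n : ℕ} {ζ : Fin (n + 1) → ℝ} {μ σ : ℝ → ℝ}
    (h : Assumption1 n ζ μ σ) (R : ℝ) : Bornology.IsBounded (μ '' Set.Ioo (-R) R) := by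
  obtain ⟨-, -, -, hleft, hright, hmid, ⟨C, q, hC, hq, hderiv⟩, -⟩ := h
  have key : ∀ a b : ℝ, ContDiffOn ℝ 1 μ (Set.Ioo a b) →
      (Set.Ioo a b ⊆ Set.Iio (ζ 0) ∪ Set.Ioi (ζ (Fin.last n)) ∪
        (⋃ i : Fin n, Set.Ioo (ζ i.castSucc) (ζ i.succ))) →
      Bornology.IsBounded (μ '' Set.Ioo a b) := by
    intro a b hd hs
    refine isBounded_image_Ioo_of_deriv_bound (M := C * (1 + max |a| |b| ^ q))
      (hd.differentiableOn one_ne_zero) fun x hx => (hderiv x (hs hx)).trans ?_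
    have hx' : |x| ≤ max |a| |b| := abs_le_max_abs_abs hx.1.le hx.2.le
    gcongr
  have hl : Bornology.IsBounded (μ '' Set.Ioo (-R) (ζ 0)) :=
    key _ _ (hleft.mono fun x hx => hx.2) fun x hx => Or.inl (Or.inl hx.2)
  have hr : Bornology.IsBounded (μ '' Set.Ioo (ζ (Fin.last n)) R) :=
    key _ _ (hright.mono fun x hx => hx.1) fun x hx => Or.inl (Or.inr hx.1)
  have hm := isBounded_image_Icc_of_pieces ζ (fun i => key _ _ (hmid i) fun x hx =>
    Or.inr (Set.mem_iUnion.2 ⟨i, hx⟩)) (Fin.last n)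
  refine ((hl.union hm).union hr).subset ?_
  rintro _ ⟨x, ⟨h0, h1⟩, rfl⟩
  rcases lt_or_ge x (ζ 0) with hx | hx
  · exact Or.inl (Or.inl ⟨x, ⟨h0, hx⟩, rfl⟩)
  · rcases le_or_gt x (ζ (Fin.last n)) with hx' | hx'
    · exact Or.inl (Or.inr ⟨x, ⟨hx, hx'⟩, rfl⟩)
    · exact Or.inr ⟨x, ⟨hx', h1⟩, rfl⟩

/-- The one-sided quadratic bound for the drift itself, without taming. -/
lemma Assumption1.exists_mul_le {n : ℕ} {ζ : Fin (n + 1) → ℝ} {μ σ : ℝ → ℝ}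
    (h : Assumption1 n ζ μ σ) :
    ∃ c : ℝ, 0 < c ∧ ∀ x : ℝ, 2 * x * μ x ≤ c * (1 + |x| ^ 2) := by
  obtain ⟨L, hL, hmono⟩ := h.2.2.1
  set R : ℝ := max |ζ 0| |ζ (Fin.last n)| + 1 with hR
  have hR0 : |ζ 0| < R := (le_max_left _ _).trans_lt (lt_add_one _)
  have hRn : |ζ (Fin.last n)| < R := (le_max_right _ _).trans_lt (lt_add_one _)
  have hRpos : 0 < R := (abs_nonneg _).trans_lt hR0
  obtain ⟨B, hB⟩ := isBounded_iff_forall_norm_le.1 (h.isBounded_image_Ioo (R + 1))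
  have hμ : ∀ x : ℝ, -R ≤ x → x ≤ R → |μ x| ≤ B := fun x h0 h1 =>
    hB _ ⟨x, ⟨by linarith, by linarith⟩, rfl⟩
  have hBnn : 0 ≤ B := (abs_nonneg _).trans (hμ R (by linarith) le_rfl)
  have hRB : 0 ≤ R * B := by positivity
  refine ⟨2 * (R * B) + B + 2 * L, by positivity, fun x => ?_⟩
  rw [sq_abs]
  have hrest : 0 ≤ 2 * (R * B) * x ^ 2 := by positivity
  have hLx : 0 ≤ L * x ^ 2 := by positivity
  have hBx : 0 ≤ B * x ^ 2 := by positivity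
  rcases lt_or_ge x (-R) with hx | hx
  · have hm := hmono x (-R) (Or.inl ⟨by linarith [neg_abs_le (ζ 0)],
      by linarith [neg_abs_le (ζ 0)]⟩)
    rw [sq_abs] at hm
    have hb := (abs_le.1 (hμ (-R) le_rfl (by linarith))).1
    have hslope : L * (x - -R) ≤ μ x - μ (-R) :=
      (mul_le_mul_left_of_neg (show x - -R < 0 by linarith)).1 (by linarith)
    have hlow : -B + L * x ≤ μ x := by nlinarith
    nlinarith [mul_nonneg hBnn (sq_nonneg (x + 1))]
  · rcases le_or_gt x R with hx' | hx'
    · have hp : x * μ x ≤ R * B := (le_abs_self _).trans <| by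
        rw [abs_mul]
        exact mul_le_mul (abs_le.2 ⟨hx, hx'⟩) (hμ x hx hx') (abs_nonneg _) hRpos.le
      nlinarith
    · have hm := hmono x R (Or.inr ⟨by linarith [le_abs_self (ζ (Fin.last n))],
        by linarith [le_abs_self (ζ (Fin.last n))]⟩)
      rw [sq_abs] at hm
      have hb := (abs_le.1 (hμ R (by linarith) le_rfl)).2
      have hslope : μ x - μ R ≤ L * (x - R) :=
        le_of_mul_le_mul_left (by linarith) (show 0 < x - R by linarith)
      have hup : μ x ≤ B + L * x := by nlinarith
      nlinarith [mul_nonneg hBnn (sq_nonneg (x - 1))]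

/-- One-sided quadratic bound for the tamed drift:
`2xμ(x)/(1+δ|μ(x)|) ≤ c(1+|x|²)` for all `δ ∈ (0,1)` and `x ∈ ℝ`. -/
theorem tamed_drift_one_sided_quadratic_bound
    (n : ℕ) (ζ : Fin (n + 1) → ℝ) (μ σ : ℝ → ℝ)
    (h1 : Assumption1 n ζ μ σ) :
    ∃ c : ℝ, 0 < c ∧ ∀ δ : ℝ, δ ∈ Set.Ioo (0 : ℝ) 1 → ∀ x : ℝ,
      2 * x * μ x / (1 + δ * |μ x|) ≤ c * (1 + |x| ^ 2) := by
  obtain ⟨c, hc, hbound⟩ := h1.exists_mul_le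
  refine ⟨c, hc, fun δ hδ x => ?_⟩
  have hδμ : 0 ≤ δ * |μ x| := mul_nonneg hδ.1.le (abs_nonneg _)
  have hrhs : 0 ≤ c * (1 + |x| ^ 2) := by positivity
  rw [div_le_iff₀ (by linarith)]
  exact (hbound x).trans (le_mul_of_one_le_right hrhs (by linarith))

end
end
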